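/- Let d ≥ 1 and let L be a finite abstract simplicial complex all of whose faces have at most d vertices, such that L does not embed linearly in ℝ^{2d−2}. Then the nerve of the family of nonempty faces of L is d-collapsible but not (2d−2)-representable. -/

import Mathlib

/-- A finite abstract simplicial complex: a finite family of finite sets
closed under taking subsets. -/
def IsComplex {V : Type*} [DecidableEq V] (K : Finset (Finset V)) : Prop :=
  ∀ σ ∈ K, ∀ τ ⊆ σ, τ ∈ K

/-- `σ` is a `d`-collapsible face of `K`: it is a face of dimension `≤ d - 1`
(i.e. with at most `d` vertices) contained in a unique inclusion-maximal face of `K`. -/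
def IsCollapsibleFace {V : Type*} [DecidableEq V] (K : Finset (Finset V)) (d : ℕ)
    (σ : Finset V) : Prop :=
  σ ∈ K ∧ σ.card ≤ d ∧
    ∃! τ, τ ∈ K ∧ σ ⊆ τ ∧ ∀ ρ ∈ K, τ ⊆ ρ → ρ = τ

/-- An elementary `d`-collapse: remove all faces `η` with `σ ⊆ η ⊆ τ`, where `σ` is a
`d`-collapsible face and `τ` is the unique maximal face containing it. -/
def ElemCollapse {V : Type*} [DecidableEq V] (d : ℕ) (K K' : Finset (Finset V)) : Prop :=
  ∃ σ τ : Finset V, σ ∈ K ∧ σ.card ≤ d ∧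
    (τ ∈ K ∧ σ ⊆ τ ∧ ∀ ρ ∈ K, τ ⊆ ρ → ρ = τ) ∧
    (∀ τ' ∈ K, σ ⊆ τ' → (∀ ρ ∈ K, τ' ⊆ ρ → ρ = τ') → τ' = τ) ∧
    K' = K.filter (fun η => ¬ (σ ⊆ η ∧ η ⊆ τ))

/-- `K` is `d`-collapsible: some sequence of elementary `d`-collapses reduces `K`
to the empty complex. -/
def Collapsible {V : Type*} [DecidableEq V] (d : ℕ) (K : Finset (Finset V)) : Prop :=
  Relation.ReflTransGen (ElemCollapse d) K ∅

/-- `K` is `d`-representable: it is (isomorphic to) the nerve of a family of convex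
sets in `ℝ^d` indexed by its vertices. -/
def Representable {V : Type*} [DecidableEq V] (d : ℕ) (K : Finset (Finset V)) : Prop :=
  ∃ C : V → Set (Fin d → ℝ), (∀ v, Convex ℝ (C v)) ∧
    ∀ σ : Finset V, σ ∈ K ↔ ∃ x, ∀ v ∈ σ, x ∈ C v

open Classical in
/-- The nerve of the family of nonempty faces of `L`: a finite subfamily of nonempty
faces of `L` is a simplex iff the faces in it have a common vertex. -/
noncomputable def nerveFaces {V : Type*} [DecidableEq V] (L : Finset (Finset V)) :
    Finset (Finset (Finset V)) :=
  (L.filter fun σ => σ.Nonempty).powerset.filter (fun G => ∃ v, ∀ σ ∈ G, v ∈ σ)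

/-- `L` embeds linearly in `ℝ^m`: there is a map `p` from the vertices to `ℝ^m` with
each `p(σ)`, `σ ∈ L`, an affinely independent point set and
`conv(p(σ)) ∩ conv(p(τ)) = conv(p(σ ∩ τ))` for all faces `σ, τ ∈ L`. -/
def EmbedsLinearly (m : ℕ) (L : Finset (Finset ℕ)) : Prop :=
  ∃ p : ℕ → (Fin m → ℝ),
    (∀ σ ∈ L, AffineIndependent ℝ ((↑) : (p '' (σ : Set ℕ)) → (Fin m → ℝ))) ∧
    (∀ σ ∈ L, ∀ τ ∈ L,
      convexHull ℝ (p '' (σ : Set ℕ)) ∩ convexHull ℝ (p '' (τ : Set ℕ)) =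
        convexHull ℝ (p '' ((σ ∩ τ : Finset ℕ) : Set ℕ)))

section Collapse

variable {V : Type*}

/-- The simplices of the nerve of `F` that have a common vertex in `X`. -/
noncomputable def nerveOn (F : Finset (Finset V)) (X : Set V) : Finset (Finset (Finset V)) := by
  classical exact F.powerset.filter fun G => ∃ v ∈ X, ∀ σ ∈ G, v ∈ σ

lemma mem_nerveOn {F : Finset (Finset V)} {X : Set V} {G : Finset (Finset V)} :
    G ∈ nerveOn F X ↔ G ⊆ F ∧ ∃ v ∈ X, ∀ σ ∈ G, v ∈ σ := by
  simp [nerveOn]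

variable [DecidableEq V]

lemma nerveFaces_eq_nerveOn (L : Finset (Finset V)) :
    nerveFaces L = nerveOn (L.filter fun σ => σ.Nonempty) Set.univ := by
  ext G
  simp only [nerveFaces, mem_nerveOn, Finset.mem_filter, Finset.mem_powerset, Set.mem_univ,
    true_and, Finset.subset_iff]

lemma ElemCollapse.subset {d : ℕ} {K K' : Finset (Finset V)} (h : ElemCollapse d K K') :
    K' ⊆ K := by
  obtain ⟨σ, τ, -, -, -, -, rfl⟩ := h
  exact Finset.filter_subset _ _

lemma ElemCollapse.union_image_insert {d : ℕ} {K M M' : Finset (Finset V)} {v : V}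
    (h : ElemCollapse d M M') (hK : ∀ η ∈ K, v ∉ η) (hM : ∀ η ∈ M, v ∉ η) :
    ElemCollapse (d + 1) (K ∪ M.image (insert v)) (K ∪ M'.image (insert v)) := by
  obtain ⟨σ, τ, hσ, hcard, ⟨hτ, hστ, hmax⟩, huniq, rfl⟩ := h
  have key : ∀ ρ ∈ K ∪ M.image (insert v), v ∈ ρ → ∃ η ∈ M, insert v η = ρ := by
    intro ρ hρ hv
    rcases Finset.mem_union.1 hρ with h | h
    · exact absurd hv (hK ρ h)
    · exact Finset.mem_image.1 h
  have ins : ∀ η ∈ M, insert v η ∈ K ∪ M.image (insert v) := fun η hη =>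
    Finset.mem_union_right _ (Finset.mem_image_of_mem _ hη)
  have sub : ∀ η ∈ M, ∀ ρ, insert v η ⊆ insert v ρ ↔ η ⊆ ρ := fun η hη ρ =>
    Finset.insert_subset_insert_iff (hM η hη)
  refine ⟨insert v σ, insert v τ, ins σ hσ, (Finset.card_insert_le _ _).trans (by omega),
    ⟨ins τ hτ, Finset.insert_subset_insert _ hστ, ?_⟩, ?_, ?_⟩
  · intro ρ hρ hle
    obtain ⟨η, hη, rfl⟩ := key ρ hρ (hle (Finset.mem_insert_self _ _))
    rw [hmax η hη ((sub τ hτ η).1 hle)]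
  · intro ρ hρ hle hρmax
    obtain ⟨η, hη, rfl⟩ := key ρ hρ (hle (Finset.mem_insert_self _ _))
    rw [huniq η hη ((sub σ hσ η).1 hle)]
    intro ξ hξ hηξ
    have := hρmax _ (ins ξ hξ) (Finset.insert_subset_insert _ hηξ)
    exact Finset.Subset.antisymm ((sub ξ hξ η).1 this.subset) hηξ
  · ext ρ
    simp only [Finset.mem_union, Finset.mem_image, Finset.mem_filter]
    constructor
    · rintro (h | ⟨η, ⟨hη, hn⟩, rfl⟩)
      · exact ⟨Or.inl h, fun hc => hK ρ h (hc.1 (Finset.mem_insert_self _ _))⟩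
      · refine ⟨Or.inr ⟨η, hη, rfl⟩, ?_⟩
        rwa [sub σ hσ, sub η hη]
    · rintro ⟨h | ⟨η, hη, rfl⟩, hn⟩
      · exact Or.inl h
      · rw [sub σ hσ, sub η hη] at hn
        exact Or.inr ⟨η, ⟨hη, hn⟩, rfl⟩

lemma ElemCollapse.cone {d : ℕ} {K K' : Finset (Finset V)} {v : V}
    (h : ElemCollapse d K K') (hK : ∀ η ∈ K, v ∉ η) :
    ElemCollapse d (K ∪ K.image (insert v)) (K' ∪ K'.image (insert v)) := by
  obtain ⟨σ, τ, hσ, hcard, ⟨hτ, hστ, hmax⟩, huniq, rfl⟩ := h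
  have ins : ∀ η ∈ K, insert v η ∈ K ∪ K.image (insert v) := fun η hη =>
    Finset.mem_union_right _ (Finset.mem_image_of_mem _ hη)
  have sub : ∀ η ∈ K, ∀ ρ, η ⊆ insert v ρ ↔ η ⊆ ρ := fun η hη ρ =>
    Finset.subset_insert_iff_of_notMem (hK η hη)
  have sub' : ∀ η ∈ K, ∀ ρ, insert v η ⊆ insert v ρ ↔ η ⊆ ρ := fun η hη ρ =>
    Finset.insert_subset_insert_iff (hK η hη)
  refine ⟨σ, insert v τ, Finset.mem_union_left _ hσ, hcard,
    ⟨ins τ hτ, hστ.trans (Finset.subset_insert _ _), ?_⟩, ?_, ?_⟩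
  · intro ρ hρ hle
    rcases Finset.mem_union.1 hρ with h | h
    · exact absurd (hle (Finset.mem_insert_self _ _)) (hK ρ h)
    · obtain ⟨η, hη, rfl⟩ := Finset.mem_image.1 h
      rw [hmax η hη ((sub' τ hτ η).1 hle)]
  · intro ρ hρ hle hρmax
    have hvρ : ∃ η ∈ K, insert v η = ρ := by
      rcases Finset.mem_union.1 hρ with h | h
      · exact ⟨ρ, h, hρmax _ (ins ρ h) (Finset.subset_insert _ _)⟩
      · exact Finset.mem_image.1 h
    obtain ⟨η, hη, rfl⟩ := hvρ
    rw [huniq η hη ((sub σ hσ η).1 hle)]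
    intro ξ hξ hηξ
    have := hρmax _ (ins ξ hξ) (Finset.insert_subset_insert _ hηξ)
    exact Finset.Subset.antisymm ((sub' ξ hξ η).1 this.subset) hηξ
  · ext ρ
    simp only [Finset.mem_union, Finset.mem_image, Finset.mem_filter]
    constructor
    · rintro (⟨h, hn⟩ | ⟨η, ⟨hη, hn⟩, rfl⟩)
      · exact ⟨Or.inl h, by rwa [sub ρ h]⟩
      · refine ⟨Or.inr ⟨η, hη, rfl⟩, ?_⟩
        rwa [sub σ hσ, sub' η hη]
    · rintro ⟨h | ⟨η, hη, rfl⟩, hn⟩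
      · exact Or.inl ⟨h, by rwa [sub ρ h] at hn⟩
      · rw [sub σ hσ, sub' η hη] at hn
        exact Or.inr ⟨η, ⟨hη, hn⟩, rfl⟩

/-- If the deletion `K` of a vertex `v` is `(d + 1)`-collapsible and its link `M` is
`d`-collapsible, then the whole complex is `(d + 1)`-collapsible. -/
lemma Collapsible.union_image_insert {d : ℕ} {K M : Finset (Finset V)} {v : V}
    (hKc : Collapsible (d + 1) K) (hMc : Collapsible d M)
    (hK : ∀ η ∈ K, v ∉ η) (hM : ∀ η ∈ M, v ∉ η) :
    Collapsible (d + 1) (K ∪ M.image (insert v)) := by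
  unfold Collapsible at hMc
  induction hMc using Relation.ReflTransGen.head_induction_on with
  | refl => simpa using hKc
  | head h _ ih =>
    exact .head (h.union_image_insert hK hM) (ih fun η hη => hM η (h.subset hη))

lemma Collapsible.cone {d : ℕ} {K : Finset (Finset V)} {v : V}
    (hKc : Collapsible d K) (hK : ∀ η ∈ K, v ∉ η) :
    Collapsible d (K ∪ K.image (insert v)) := by
  unfold Collapsible at hKc
  induction hKc using Relation.ReflTransGen.head_induction_on with
  | refl => exact .refl
  | head h _ ih => exact .head (h.cone hK) (ih fun η hη => hK η (h.subset hη))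

lemma nerveOn_insert {F : Finset (Finset V)} {σ : Finset V} (X : Set V) :
    nerveOn (insert σ F) X = nerveOn F X ∪ (nerveOn F (X ∩ σ)).image (insert σ) := by
  ext G
  simp only [Finset.mem_union, Finset.mem_image, mem_nerveOn]
  constructor
  · rintro ⟨hG, v, hv, h⟩
    by_cases hσG : σ ∈ G
    · refine Or.inr ⟨G.erase σ, ⟨Finset.subset_insert_iff.1 hG, v, ⟨hv, h σ hσG⟩,
        fun τ hτ => h τ (Finset.mem_of_mem_erase hτ)⟩, Finset.insert_erase hσG⟩
    · exact Or.inl ⟨(Finset.subset_insert_iff_of_notMem hσG).1 hG, v, hv, h⟩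
  · rintro (⟨hG, v, hv, h⟩ | ⟨G, ⟨hG, v, hv, h⟩, rfl⟩)
    · exact ⟨hG.trans (Finset.subset_insert _ _), v, hv, h⟩
    · exact ⟨Finset.insert_subset_insert _ hG, v, hv.1,
        Finset.forall_mem_insert _ _ _ |>.2 ⟨hv.2, h⟩⟩

lemma collapsible_nerveOn (F : Finset (Finset V)) :
    ∀ (d : ℕ) (X : Set V), X.Nonempty →
      (∀ σ ∈ F, X ⊆ σ ∨ (X ∩ (σ : Set V)).ncard ≤ d) → Collapsible d (nerveOn F X) := by
  induction F using Finset.induction_on with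
  | empty =>
    rintro d X ⟨v, hv⟩ -
    refine .single ⟨∅, ∅, ?_, by simp, ⟨?_, le_rfl, ?_⟩, ?_, ?_⟩
    · simpa [mem_nerveOn] using ⟨v, hv⟩
    · simpa [mem_nerveOn] using ⟨v, hv⟩
    · intro ρ hρ _
      simpa using (mem_nerveOn.1 hρ).1
    · intro ρ hρ _ _
      simpa using (mem_nerveOn.1 hρ).1
    · ext ρ
      simp only [Finset.notMem_empty, Finset.mem_filter, mem_nerveOn, Finset.subset_empty]
      refine ⟨False.elim, ?_⟩
      rintro ⟨⟨rfl, -⟩, h⟩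
      simp at h
  | insert σ F hσ ih =>
    intro d X hX h
    have hF : ∀ Y : Set V, ∀ η ∈ nerveOn F Y, σ ∉ η := fun Y η hη hc =>
      hσ ((mem_nerveOn.1 hη).1 hc)
    have hdel := ih d X hX fun τ hτ => h τ (Finset.mem_insert_of_mem hτ)
    rw [nerveOn_insert X]
    rcases h σ (Finset.mem_insert_self _ _) with hXσ | hcard
    · rw [Set.inter_eq_left.2 hXσ]
      exact hdel.cone (hF X)
    rcases Set.eq_empty_or_nonempty (X ∩ (σ : Set V)) with hem | hne
    · have : nerveOn F (X ∩ (σ : Set V)) = ∅ := by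
        ext G
        simp [mem_nerveOn, hem]
      simpa [this] using hdel
    obtain ⟨d, rfl⟩ : ∃ e, d = e + 1 := by
      have := (Set.ncard_pos (σ.finite_toSet.inter_of_right X)).2 hne
      exact ⟨d - 1, by omega⟩
    refine hdel.union_image_insert (ih d _ hne fun τ hτ => ?_) (hF _) (hF _)
    by_cases hsub : X ∩ (σ : Set V) ⊆ τ
    · exact Or.inl hsub
    · obtain ⟨v, hv, hvτ⟩ := Set.not_subset.1 hsub
      refine Or.inr (Nat.lt_succ_iff.1 (lt_of_lt_of_le (Set.ncard_lt_ncard ?_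
        (σ.finite_toSet.inter_of_right X)) hcard))
      exact (Set.ssubset_iff_of_subset Set.inter_subset_left).2 ⟨v, hv, fun hc => hvτ hc.2⟩

end Collapse

section GeneralPosition

open Filter Topology

/-- The matrix of homogeneous coordinates of `m + 1` points of `ℝ^m`. -/
def homogeneousMatrix {R : Type*} [One R] {m : ℕ} (p : Fin (m + 1) → Fin m → R) :
    Matrix (Fin (m + 1)) (Fin (m + 1)) R :=
  Matrix.of fun i => Fin.cons 1 (p i)

lemma affineIndependent_of_det_ne_zero {m : ℕ} {p : Fin (m + 1) → Fin m → ℝ}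
    (h : (homogeneousMatrix p).det ≠ 0) : AffineIndependent ℝ p := by
  rw [affineIndependent_iff_of_fintype]
  intro w hw hp
  rw [Finset.weightedVSub_eq_linear_combination (hw := hw)] at hp
  have : Matrix.vecMul w (homogeneousMatrix p) = 0 := by
    ext j
    refine Fin.cases ?_ (fun k => ?_) j
    · simpa [Matrix.vecMul, dotProduct, homogeneousMatrix] using hw
    · simpa [Matrix.vecMul, dotProduct, homogeneousMatrix] using congrFun hp k
  exact congrFun (Matrix.eq_zero_of_vecMul_eq_zero h this)

/-- The moment curve in `ℝ^m`. -/
def momentCurve (m : ℕ) (x : ℝ) : Fin m → ℝ := fun j => x ^ (j.val + 1)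

lemma det_homogeneousMatrix_momentCurve {m : ℕ} {x : Fin (m + 1) → ℝ}
    (hx : Function.Injective x) :
    (homogeneousMatrix fun i => momentCurve m (x i)).det ≠ 0 := by
  have : homogeneousMatrix (fun i => momentCurve m (x i)) = Matrix.vandermonde x := by
    ext i j
    refine Fin.cases ?_ (fun k => ?_) j <;>
      simp [homogeneousMatrix, momentCurve, Matrix.vandermonde]
  rw [this]
  exact Matrix.det_vandermonde_ne_zero_iff.2 hx

lemma eventually_affineIndependent_lineMap {m : ℕ} {p q : Fin (m + 1) → Fin m → ℝ}
    (hq : (homogeneousMatrix q).det ≠ 0) :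
    ∀ᶠ t : ℝ in 𝓝[>] 0, AffineIndependent ℝ fun i => AffineMap.lineMap (p i) (q i) t := by
  let P : Polynomial ℝ := (homogeneousMatrix fun i j =>
    Polynomial.C (p i j) + Polynomial.X * Polynomial.C (q i j - p i j)).det
  have hP : ∀ t, P.eval t =
      (homogeneousMatrix fun i => AffineMap.lineMap (p i) (q i) t).det := by
    intro t
    rw [← Polynomial.coe_evalRingHom, RingHom.map_det]
    congr 1
    ext i j
    refine Fin.cases ?_ (fun k => ?_) j
    · simp [homogeneousMatrix]
    · simp [homogeneousMatrix, AffineMap.lineMap_apply]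
      ring
  have hP0 : P ≠ 0 := by
    intro h0
    apply hq
    have := hP 1
    simpa [h0] using this.symm
  have hfin : {t | P.IsRoot t}.Finite := Polynomial.finite_setOfPred_isRoot hP0
  have : ∀ᶠ t : ℝ in 𝓝[>] 0, t ∉ {t | P.IsRoot t} := by
    have h := (hfin.subset Set.sdiff_subset : ({t | P.IsRoot t} \ {0}).Finite).isClosed.isOpen_compl
    have h1 : ∀ᶠ t : ℝ in 𝓝[>] 0, t ∈ ({t | P.IsRoot t} \ {0})ᶜ :=
      nhdsWithin_le_nhds (h.mem_nhds (by simp))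
    filter_upwards [h1, self_mem_nhdsWithin] with t ht ht0 hc
    exact ht ⟨hc, (ne_of_gt ht0 : t ≠ 0)⟩
  filter_upwards [this] with t ht
  refine affineIndependent_of_det_ne_zero ?_
  rw [← hP]
  exact ht

lemma eventually_disjoint_convexHull {E ι : Type*} [NormedAddCommGroup E] [NormedSpace ℝ E]
    {p q : ι → E} {σ τ : Set ι} (hσ : σ.Finite) (hτ : τ.Finite)
    (h : Disjoint (convexHull ℝ (p '' σ)) (convexHull ℝ (p '' τ))) :
    ∀ᶠ t : ℝ in 𝓝 0,
      Disjoint (convexHull ℝ ((fun v => AffineMap.lineMap (p v) (q v) t) '' σ))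
        (convexHull ℝ ((fun v => AffineMap.lineMap (p v) (q v) t) '' τ)) := by
  obtain ⟨δ, hδ, hdis⟩ := h.exists_thickenings ((hσ.image p).isCompact_convexHull (𝕜 := ℝ))
    ((hτ.image p).isCompact_convexHull (𝕜 := ℝ)).isClosed
  have key : ∀ ρ : Set ι, ρ.Finite → ∀ᶠ t : ℝ in 𝓝 0,
      convexHull ℝ ((fun v => AffineMap.lineMap (p v) (q v) t) '' ρ) ⊆
        Metric.thickening δ (convexHull ℝ (p '' ρ)) := by
    intro ρ hρ
    have : ∀ᶠ t : ℝ in 𝓝 0, ∀ v ∈ ρ, AffineMap.lineMap (p v) (q v) t ∈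
        Metric.thickening δ (convexHull ℝ (p '' ρ)) := by
      rw [Filter.eventually_all_finite hρ]
      intro v hv
      have hc : Continuous fun t : ℝ => (AffineMap.lineMap (p v) (q v) t : E) :=
        AffineMap.lineMap_continuous
      refine hc.continuousAt.eventually_mem (Metric.isOpen_thickening.mem_nhds ?_)
      rw [AffineMap.lineMap_apply_zero]
      exact Metric.self_subset_thickening hδ _
        (subset_convexHull ℝ _ (Set.mem_image_of_mem p hv))
    filter_upwards [this] with t ht
    exact convexHull_min (Set.image_subset_iff.2 ht) ((convex_convexHull ℝ _).thickening δ)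
  filter_upwards [key σ hσ, key τ hτ] with t h1 h2
  exact hdis.mono h1 h2

/-- A map of the vertices under which disjoint faces have disjoint convex hulls can be perturbed
to a linear embedding when any two intersecting faces have at most `m + 1` vertices in total. -/
lemma embedsLinearly_of_disjoint {m : ℕ} {L : Finset (Finset ℕ)}
    (hcard : ∀ σ ∈ L, σ.card ≤ m + 1)
    (hcard₂ : ∀ σ ∈ L, ∀ τ ∈ L, ¬ Disjoint σ τ → (σ ∪ τ).card ≤ m + 1)
    (p : ℕ → Fin m → ℝ)
    (hp : ∀ σ ∈ L, ∀ τ ∈ L, Disjoint σ τ →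
      Disjoint (convexHull ℝ (p '' (σ : Set ℕ))) (convexHull ℝ (p '' (τ : Set ℕ)))) :
    EmbedsLinearly m L := by
  classical
  let r : ℝ → ℕ → Fin m → ℝ := fun t v => AffineMap.lineMap (p v) (momentCurve m v) t
  let T : Finset ℕ := L.sup id ∪ Finset.range (m + 1)
  have hind : ∀ᶠ t : ℝ in 𝓝[>] 0, ∀ S ∈ T.powersetCard (m + 1),
      AffineIndependent ℝ fun v : S => r t v := by
    rw [Filter.eventually_all_finset]
    intro S hS
    have hS := (Finset.mem_powersetCard.1 hS).2
    have hinj : Function.Injective fun i => ((S.orderIsoOfFin hS i : ℕ) : ℝ) :=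
      Nat.cast_injective.comp (Subtype.val_injective.comp (S.orderIsoOfFin hS).injective)
    filter_upwards [eventually_affineIndependent_lineMap
      (p := fun i => p (S.orderIsoOfFin hS i))
      (det_homogeneousMatrix_momentCurve hinj)] with t ht
    exact (affineIndependent_equiv (S.orderIsoOfFin hS).toEquiv
      (p := fun v : S => r t v)).1 ht
  have hdis : ∀ᶠ t : ℝ in 𝓝[>] 0, ∀ σ ∈ L, ∀ τ ∈ L, Disjoint σ τ →
      Disjoint (convexHull ℝ (r t '' (σ : Set ℕ))) (convexHull ℝ (r t '' (τ : Set ℕ))) := by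
    simp only [Filter.eventually_all_finset, Filter.eventually_imp_distrib_left]
    intro σ hσ τ hτ h
    exact nhdsWithin_le_nhds
      (eventually_disjoint_convexHull σ.finite_toSet τ.finite_toSet (hp σ hσ τ hτ h))
  obtain ⟨t, hind, hdis⟩ := (hind.and hdis).exists
  have ind : ∀ U : Finset ℕ, U ⊆ L.sup id → U.card ≤ m + 1 →
      Set.InjOn (r t) U ∧ AffineIndependent ℝ ((↑) : (r t '' (U : Set ℕ)) → Fin m → ℝ) := by
    intro U hU hUc
    have hTc : m + 1 ≤ T.card := by
      simpa using Finset.card_le_card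
        (Finset.subset_union_right : Finset.range (m + 1) ⊆ T)
    obtain ⟨S, hUS, hST, hSc⟩ := Finset.exists_subsuperset_card_eq
      (hU.trans Finset.subset_union_left : U ⊆ T) hUc hTc
    have hS := hind S (Finset.mem_powersetCard.2 ⟨hST, hSc⟩)
    have hinj : Set.InjOn (r t) S := Set.injOn_iff_injective.2 hS.injective
    refine ⟨hinj.mono (by exact_mod_cast hUS), ?_⟩
    have hr := hS.range
    have : Set.range (fun v : S => r t v) = r t '' (S : Set ℕ) := by
      ext x; simp
    rw [this] at hr
    exact hr.mono (Set.image_mono (by exact_mod_cast hUS))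
  have hsup : ∀ σ ∈ L, σ ⊆ L.sup id := fun σ hσ => Finset.le_sup (f := id) hσ
  refine ⟨r t, fun σ hσ => (ind σ (hsup σ hσ) (hcard σ hσ)).2, fun σ hσ τ hτ => ?_⟩
  by_cases hst : Disjoint σ τ
  · rw [Finset.disjoint_iff_inter_eq_empty.1 hst,
      Set.disjoint_iff_inter_eq_empty.1 (hdis σ hσ τ hτ hst)]
    simp
  · obtain ⟨hinj, haff⟩ := ind (σ ∪ τ) (Finset.union_subset (hsup σ hσ) (hsup τ hτ))
      (hcard₂ σ hσ τ hτ hst)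
    have haff' : AffineIndependent ℝ ((↑) : ((σ ∪ τ).image (r t)) → Fin m → ℝ) := by
      have h : (r t '' ((σ ∪ τ : Finset ℕ) : Set ℕ)) = (((σ ∪ τ).image (r t) : Finset _) : Set _) :=
        Finset.coe_image.symm
      rw [h] at haff
      exact haff
    have := haff'.convexHull_inter
      (t₁ := σ.image (r t)) (t₂ := τ.image (r t))
      (Finset.image_subset_image Finset.subset_union_left)
      (Finset.image_subset_image Finset.subset_union_right)
    simp only [Finset.coe_image] at this
    rw [← this, Finset.coe_inter, hinj.image_inter (by simp) (by simp)]

end GeneralPosition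

lemma Representable.exists_disjoint_convexHull {m : ℕ} {L : Finset (Finset ℕ)}
    (h : Representable m (nerveFaces L)) :
    ∃ p : ℕ → Fin m → ℝ, ∀ σ ∈ L, ∀ τ ∈ L, Disjoint σ τ →
      Disjoint (convexHull ℝ (p '' (σ : Set ℕ))) (convexHull ℝ (p '' (τ : Set ℕ))) := by
  obtain ⟨C, hC, hN⟩ := h
  have hp : ∀ v : ℕ, ∃ x, ∀ σ ∈ L, v ∈ σ → x ∈ C σ := by
    intro v
    obtain ⟨x, hx⟩ := (hN (L.filter fun σ => v ∈ σ)).1 (by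
      rw [nerveFaces_eq_nerveOn, mem_nerveOn]
      refine ⟨fun σ hσ => ?_, v, trivial, fun σ hσ => (Finset.mem_filter.1 hσ).2⟩
      rw [Finset.mem_filter] at hσ ⊢
      exact ⟨hσ.1, v, hσ.2⟩)
    exact ⟨x, fun σ hσ hv => hx σ (Finset.mem_filter.2 ⟨hσ, hv⟩)⟩
  choose p hp using hp
  have hsub : ∀ σ ∈ L, convexHull ℝ (p '' (σ : Set ℕ)) ⊆ C σ := fun σ hσ =>
    convexHull_min (Set.image_subset_iff.2 fun v hv => hp v σ hσ hv) (hC σ)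
  refine ⟨p, fun σ hσ τ hτ hst => Set.disjoint_left.2 fun x hxσ hxτ => ?_⟩
  have hmem := (hN {σ, τ}).2 ⟨x, by simpa using ⟨hsub σ hσ hxσ, hsub τ hτ hxτ⟩⟩
  rw [nerveFaces_eq_nerveOn, mem_nerveOn] at hmem
  obtain ⟨-, v, -, hv⟩ := hmem
  exact Finset.disjoint_left.1 hst (hv σ (by simp)) (hv τ (by simp))

/-- If `d ≥ 1` and `L` is a finite simplicial complex all of whose faces have at most
`d` vertices and which does not embed linearly in `ℝ^{2d-2}`, then the nerve of the
family of nonempty faces of `L` is `d`-collapsible but not `(2d-2)`-representable. -/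
theorem nerve_collapsible_not_representable (d : ℕ) (hd : 1 ≤ d)
    (L : Finset (Finset ℕ)) (hL : IsComplex L)
    (hcard : ∀ σ ∈ L, σ.card ≤ d)
    (hemb : ¬ EmbedsLinearly (2 * d - 2) L) :
    Collapsible d (nerveFaces L) ∧ ¬ Representable (2 * d - 2) (nerveFaces L) := by
  constructor
  · rw [nerveFaces_eq_nerveOn]
    refine collapsible_nerveOn _ d _ Set.univ_nonempty fun σ hσ => Or.inr ?_
    simpa using hcard σ (Finset.mem_filter.1 hσ).1
  · intro h
    obtain ⟨p, hp⟩ := h.exists_disjoint_convexHull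
    refine hemb (embedsLinearly_of_disjoint (fun σ hσ => ?_) (fun σ hσ τ hτ hst => ?_) p hp)
    · have := hcard σ hσ
      omega
    · have h1 := hcard σ hσ
      have h2 := hcard τ hτ
      have h3 := Finset.card_union_add_card_inter σ τ
      have h4 : 0 < (σ ∩ τ).card :=
        Finset.card_pos.2 (Finset.not_disjoint_iff_nonempty_inter.1 hst)
      omega
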